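/- arXiv:math/0312512 — 3 statements merged into one kernel-verified Lean document; each statement's English description precedes it below -/
import Mathlib

section
/- Let S be a modular S-matrix on a finite type L with distinguished element 1. Suppose z : L → ℂ satisfies z(1) = 1 and, for every μ ∈ L, the map λ ↦ z(λ) · S λ μ / S 1 μ is multiplicative over the fusion ring, i.e. (z(λ₁) S λ₁ μ / S 1 μ) · (z(λ₂) S λ₂ μ / S 1 μ) = ∑_{λ₃ ∈ L} N λ₁ λ₂ λ₃ · z(λ₃) · S λ₃ μ / S 1 μ for all λ₁, λ₂ ∈ L. Then there exists τ ∈ L with S 1 τ = S 1 1 (i.e. d τ = 1, τ is an automorphism) such that z(λ) = S λ τ / S λ 1 for all λ ∈ L. -/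
open scoped BigOperators

/-- Verlinde fusion numbers associated to a matrix `S` and the vacuum label `one`. -/
noncomputable def verlindeN {L : Type*} [Fintype L] (S : Matrix L L ℂ) (one : L)
    (l m n : L) : ℂ :=
  ∑ δ, S l δ * S m δ * (starRingEnd ℂ) (S n δ) / S one δ

/-- `S` is a modular S-matrix: unitary, symmetric, with strictly positive first row,
and all Verlinde numbers nonnegative integers. -/
def IsModularS {L : Type*} [Fintype L] [DecidableEq L] (one : L) (S : Matrix L L ℂ) : Prop :=
  S * S.conjTranspose = 1 ∧
  (∀ l m, S l m = S m l) ∧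
  (∀ l, ∃ r : ℝ, 0 < r ∧ S one l = (r : ℂ)) ∧
  (∀ l m n, ∃ k : ℕ, verlindeN S one l m n = (k : ℂ))

/-- Orthonormality of the rows of a unitary matrix. -/
lemma sum_mul_star_row {L : Type*} [Fintype L] [DecidableEq L] {S : Matrix L L ℂ}
    (hU : S * S.conjTranspose = 1) (a b : L) :
    ∑ δ, S a δ * (starRingEnd ℂ) (S b δ) = if a = b then 1 else 0 := by
  have h := congrFun (congrFun hU a) b
  simpa [Matrix.mul_apply, Matrix.one_apply, Matrix.conjTranspose_apply] using h

/-- A character of the fusion ring is one of the columns of `S`, normalized by the first row. -/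
lemma exists_column_of_fusion_character {L : Type*} [Fintype L] [DecidableEq L] {one : L}
    {S : Matrix L L ℂ} (hU : S * S.conjTranspose = 1) (f : L → ℂ) (hf1 : f one ≠ 0)
    (hf : ∀ a b, f a * f b = ∑ c, verlindeN S one a b c * f c) :
    ∃ τ, ∀ a, f a = S a τ / S one τ := by
  set g : L → ℂ := fun δ => ∑ c, (starRingEnd ℂ) (S c δ) * f c with hg
  have expand : ∀ b, f b = ∑ δ, S b δ * g δ := by
    intro b
    simp only [hg, Finset.mul_sum]
    rw [Finset.sum_comm]
    simp only [← mul_assoc, ← Finset.sum_mul, sum_mul_star_row hU]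
    simp
  have key : ∀ a δ, (f a - S a δ / S one δ) * g δ = 0 := by
    intro a
    have h0 : S.mulVec (fun δ => (f a - S a δ / S one δ) * g δ) = 0 := by
      ext b
      have h1 : f a * f b = ∑ δ, S b δ * (S a δ / S one δ * g δ) := by
        rw [hf]
        simp only [verlindeN, hg, Finset.mul_sum, Finset.sum_mul]
        rw [Finset.sum_comm]
        refine Finset.sum_congr rfl fun δ _ => Finset.sum_congr rfl fun c _ => ?_
        ring
      rw [expand b, Finset.mul_sum] at h1
      simp only [Matrix.mulVec, dotProduct, Pi.zero_apply]
      rw [← sub_eq_zero, ← Finset.sum_sub_distrib] at h1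
      rw [← h1]
      exact Finset.sum_congr rfl fun δ _ => by ring
    have h2 := congrArg (S.conjTranspose.mulVec) h0
    rw [Matrix.mulVec_mulVec, mul_eq_one_comm.mp hU, Matrix.one_mulVec, Matrix.mulVec_zero] at h2
    exact fun δ => congrFun h2 δ
  obtain ⟨τ, hτ⟩ : ∃ τ, g τ ≠ 0 := by
    by_contra! h
    exact hf1 (by rw [expand]; simp [h])
  exact ⟨τ, fun a => sub_eq_zero.mp ((mul_eq_zero.mp (key a τ)).resolve_right hτ)⟩

/-- If all twists of the characters by `z` are multiplicative, then `z` is a grading of the fusion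
ring: `z a * z b = z c` whenever `c` occurs in the product of `a` and `b`. -/
lemma mul_eq_of_verlindeN_ne_zero {L : Type*} [Fintype L] [DecidableEq L] {one : L}
    {S : Matrix L L ℂ} (hU : S * S.conjTranspose = 1) (hne : ∀ μ, S one μ ≠ 0) {z : L → ℂ}
    (hmul : ∀ μ l₁ l₂, (z l₁ * S l₁ μ / S one μ) * (z l₂ * S l₂ μ / S one μ)
      = ∑ l₃, verlindeN S one l₁ l₂ l₃ * z l₃ * S l₃ μ / S one μ)
    {a b c : L} (hN : verlindeN S one a b c ≠ 0) : z a * z b = z c := by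
  have h1 : ∀ μ, z a * z b * (S a μ * S b μ * (starRingEnd ℂ) (S c μ) / S one μ)
      = ∑ l, verlindeN S one a b l * z l * (S l μ * (starRingEnd ℂ) (S c μ)) := by
    intro μ
    have h := congrArg (fun x => x * S one μ * (starRingEnd ℂ) (S c μ)) (hmul μ a b)
    simp only [Finset.sum_mul] at h
    have hμ := hne μ
    calc _ = _ := by field_simp
      _ = _ := h
      _ = _ := Finset.sum_congr rfl fun l _ => by field_simp
  have h2 : z a * z b * verlindeN S one a b c = verlindeN S one a b c * z c := by
    conv_lhs => rw [verlindeN, Finset.mul_sum]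
    simp only [h1]
    rw [Finset.sum_comm]
    simp only [← Finset.mul_sum, sum_mul_star_row hU]
    simp
  exact mul_right_cancel₀ hN (h2.trans (mul_comm _ _))

/-- A function twisting all characters to multiplicative functions takes values of modulus one. -/
lemma norm_eq_one_of_fusion_multiplicative {L : Type*} [Fintype L] [DecidableEq L] {one : L}
    {S : Matrix L L ℂ} (hU : S * S.conjTranspose = 1) (hsymm : ∀ l m, S l m = S m l)
    (hpos : ∀ l, ∃ r : ℝ, 0 < r ∧ S one l = (r : ℂ)) {z : L → ℂ} (hz1 : z one = 1)
    (hmul : ∀ μ l₁ l₂, (z l₁ * S l₁ μ / S one μ) * (z l₂ * S l₂ μ / S one μ)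
      = ∑ l₃, verlindeN S one l₁ l₂ l₃ * z l₃ * S l₃ μ / S one μ) (a : L) : ‖z a‖ = 1 := by
  have hne : ∀ μ, S one μ ≠ 0 := by
    intro μ
    obtain ⟨r, hr, h⟩ := hpos μ
    rw [h]
    exact_mod_cast hr.ne'
  have hle : ∀ a, ‖z a‖ ≤ 1 := by
    intro a
    obtain ⟨b, -, hb⟩ := Finset.exists_max_image Finset.univ (fun l => ‖z l‖) ⟨one, Finset.mem_univ _⟩
    have hb1 : 1 ≤ ‖z b‖ := by simpa [hz1] using hb one (Finset.mem_univ _)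
    have hprod : ‖z a‖ * ‖z b‖ ≤ ‖z b‖ := by
      by_cases h : ∃ c, verlindeN S one a b c ≠ 0
      · obtain ⟨c, hc⟩ := h
        rw [← norm_mul, mul_eq_of_verlindeN_ne_zero hU hne hmul hc]
        exact hb c (Finset.mem_univ _)
      · push Not at h
        have h0 := hmul one a b
        simp only [h, zero_mul, zero_div, Finset.sum_const_zero] at h0
        have ha : S a one ≠ 0 := hsymm a one ▸ hne a
        have hb' : S b one ≠ 0 := hsymm b one ▸ hne b
        have h0' : z a * z b = 0 := by simpa [ha, hb', hne] using h0
        rw [← norm_mul, h0', norm_zero]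
        exact norm_nonneg _
    nlinarith
  obtain ⟨b, hb⟩ : ∃ b, verlindeN S one a b one ≠ 0 := by
    by_contra! h
    have h0 : S.mulVec (fun δ => S a δ) = 0 := by
      ext b
      rw [Pi.zero_apply, ← h b]
      refine Finset.sum_congr rfl fun δ _ => ?_
      have hδ := hne δ
      have hc : (starRingEnd ℂ) (S one δ) = S one δ := by
        obtain ⟨r, -, hr⟩ := hpos δ
        rw [hr, Complex.conj_ofReal]
      rw [hc]
      field_simp
    have h2 := congrArg (S.conjTranspose.mulVec) h0
    rw [Matrix.mulVec_mulVec, mul_eq_one_comm.mp hU, Matrix.one_mulVec, Matrix.mulVec_zero] at h2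
    exact hne a (hsymm one a ▸ congrFun h2 one)
  have h1 : ‖z a‖ * ‖z b‖ = 1 := by
    rw [← norm_mul, mul_eq_of_verlindeN_ne_zero hU hne hmul hb, hz1, norm_one]
  nlinarith [hle a, hle b, norm_nonneg (z a), norm_nonneg (z b)]

/-- if `z : L → ℂ` with `z 1 = 1` is such that for every `μ` the map
`λ ↦ z λ · S λ μ / S 1 μ` is multiplicative over the fusion ring, then there exists an
automorphism `τ` (i.e. `S 1 τ = S 1 1`) with `z λ = S λ τ / S λ 1` for all `λ`. -/
theorem twist_of_fusion_multiplicative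
    {L : Type*} [Fintype L] [DecidableEq L] (one : L) (S : Matrix L L ℂ)
    (hS : IsModularS one S)
    (z : L → ℂ) (hz1 : z one = 1)
    (hmul : ∀ μ l₁ l₂, (z l₁ * S l₁ μ / S one μ) * (z l₂ * S l₂ μ / S one μ)
      = ∑ l₃, verlindeN S one l₁ l₂ l₃ * z l₃ * S l₃ μ / S one μ) :
    ∃ τ : L, S one τ = S one one ∧ ∀ l, z l = S l τ / S l one := by
  obtain ⟨hU, hsymm, hpos, -⟩ := hS
  have hne : ∀ μ, S one μ ≠ 0 := by
    intro μ
    obtain ⟨r, hr, h⟩ := hpos μ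
    rw [h]
    exact_mod_cast hr.ne'
  have hz := norm_eq_one_of_fusion_multiplicative hU hsymm hpos hz1 hmul
  obtain ⟨τ, hτ⟩ := exists_column_of_fusion_character hU (one := one)
    (fun l => z l * S l one / S one one) (by simp [hz1, hne]) (fun a b => by
      rw [hmul one a b]
      exact Finset.sum_congr rfl fun c _ => by ring)
  have hcol : ∀ μ, ∑ l, ‖S l μ‖ ^ 2 = 1 := by
    intro μ
    have h := sum_mul_star_row hU μ μ
    simp only [Complex.mul_conj', if_true, hsymm μ] at h
    exact_mod_cast h
  obtain ⟨r, hr, hr'⟩ := hpos one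
  obtain ⟨s, hs, hs'⟩ := hpos τ
  have hnorm : ∀ l, ‖S l one‖ ^ 2 * s ^ 2 = ‖S l τ‖ ^ 2 * r ^ 2 := by
    intro l
    have h := congrArg norm (hτ l)
    simp only [norm_div, norm_mul, hz, one_mul, hr', hs', Complex.norm_real, Real.norm_eq_abs,
      abs_of_pos hr, abs_of_pos hs] at h
    rw [div_eq_div_iff hr.ne' hs.ne'] at h
    rw [← mul_pow, h, mul_pow]
  have hsq : s ^ 2 = r ^ 2 := by
    have h := Finset.sum_congr (rfl : (Finset.univ : Finset L) = Finset.univ) fun l _ => hnorm l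
    simpa only [← Finset.sum_mul, hcol, one_mul] using h
  have hsr : s = r := (pow_left_inj₀ hs.le hr.le two_ne_zero).mp hsq
  have hττ : S one τ = S one one := by rw [hr', hs', hsr]
  refine ⟨τ, hττ, fun l => ?_⟩
  have hl : S l one ≠ 0 := hsymm l one ▸ hne l
  have h := hτ l
  simp only [hττ] at h
  rw [div_left_inj' (hne one)] at h
  exact (eq_div_iff hl).mpr h
end

section
/- Let S be a modular S-matrix on a finite type L with distinguished element 1, and let τ ∈ L satisfy S 1 τ = S 1 1 (i.e. d τ = 1, τ is an automorphism). Then fusion with τ is a permutation: there exists a bijection t : L ≃ L such that for all λ, ν ∈ L one has N τ λ ν = 1 if ν = t(λ) and N τ λ ν = 0 otherwise, and moreover S (t λ) μ · S 1 μ = S τ μ · S λ μ for all λ, μ ∈ L. -/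
open scoped BigOperators

/-- A square matrix of natural numbers such that it and its transpose fix a strictly positive
vector is a permutation matrix. -/
theorem exists_equiv_of_nat_matrix_fixing_pos {L : Type*} [Fintype L] [DecidableEq L]
    (N : Matrix L L ℕ) (w : L → ℝ) (hw : ∀ l, 0 < w l)
    (hrow : ∀ l, ∑ n, (N l n : ℝ) * w n = w l) (hcol : ∀ n, ∑ l, (N l n : ℝ) * w l = w n) :
    ∃ t : L ≃ L, ∀ l n, N l n = if n = t l then 1 else 0 := by
  have hrow_sq : ∀ l, ∑ n, (N l n : ℝ) * w n ^ 2 ≤ w l ^ 2 := by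
    intro l
    have hle : ∀ n, (N l n : ℝ) * w n ^ 2 ≤ N l n * w n * w l := by
      intro n
      have hNw : (N l n : ℝ) * w n ≤ w l := by
        rw [← hrow l]
        exact Finset.single_le_sum (f := fun n => (N l n : ℝ) * w n)
          (fun i _ => mul_nonneg (Nat.cast_nonneg _) (hw i).le) (Finset.mem_univ n)
      rcases Nat.eq_zero_or_pos (N l n) with h | h
      · simp [h]
      · have h1 : (1 : ℝ) ≤ N l n := by exact_mod_cast h
        have hwn : w n ≤ w l := (le_mul_of_one_le_left (hw n).le h1).trans hNw
        rw [pow_two, ← mul_assoc]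
        exact mul_le_mul_of_nonneg_left hwn (mul_nonneg (Nat.cast_nonneg _) (hw n).le)
    calc ∑ n, (N l n : ℝ) * w n ^ 2 ≤ ∑ n, (N l n : ℝ) * w n * w l :=
          Finset.sum_le_sum fun n _ => hle n
      _ = w l ^ 2 := by rw [← Finset.sum_mul, hrow, pow_two]
  have hcol_pos : ∀ n, 1 ≤ ∑ l, N l n := by
    intro n
    by_contra! h
    have h0 : ∀ l, N l n = 0 := by simpa using h
    have := hcol n
    simp only [h0, Nat.cast_zero, zero_mul, Finset.sum_const_zero] at this
    exact (hw n).ne this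
  have hcol_le : ∀ n ∈ Finset.univ, w n ^ 2 ≤ (∑ l, (N l n : ℝ)) * w n ^ 2 := by
    intro n _
    have h1 : (1 : ℝ) ≤ ∑ l, (N l n : ℝ) := by exact_mod_cast hcol_pos n
    exact le_mul_of_one_le_left (sq_nonneg _) h1
  have htotal : ∑ n, w n ^ 2 = ∑ n, (∑ l, (N l n : ℝ)) * w n ^ 2 := by
    refine le_antisymm (Finset.sum_le_sum hcol_le) ?_
    simp_rw [Finset.sum_mul]
    rw [Finset.sum_comm]
    exact Finset.sum_le_sum fun l _ => hrow_sq l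
  have hcol_one : ∀ n, ∑ l, N l n = 1 := by
    intro n
    have h := (Finset.sum_eq_sum_iff_of_le hcol_le).1 htotal n (Finset.mem_univ n)
    have h1 : (∑ l, (N l n : ℝ)) = 1 :=
      mul_right_cancel₀ (pow_pos (hw n) 2).ne' (by rw [one_mul]; exact h.symm)
    exact_mod_cast h1
  have hsupp : ∀ n, ∃ s, ∀ l, N l n = if l = s then 1 else 0 := by
    intro n
    obtain ⟨s, -, hs⟩ := Finset.exists_ne_zero_of_sum_ne_zero
      (by rw [hcol_one n]; exact one_ne_zero : ∑ l, N l n ≠ 0)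
    have hsplit := Finset.add_sum_erase Finset.univ (fun l => N l n) (Finset.mem_univ s)
    simp only [hcol_one n] at hsplit
    refine ⟨s, fun l => ?_⟩
    split_ifs with hl
    · subst hl
      omega
    · have := Finset.single_le_sum (f := fun l => N l n) (fun i _ => Nat.zero_le _)
        (Finset.mem_erase.2 ⟨hl, Finset.mem_univ l⟩)
      omega
  choose s hs using hsupp
  have hsurj : Function.Surjective s := by
    intro l
    by_contra! h
    have := hrow l
    simp only [hs, if_neg (h _).symm, Nat.cast_zero, zero_mul, Finset.sum_const_zero] at this
    exact (hw l).ne this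
  let e : L ≃ L := Equiv.ofBijective s (Finite.surjective_iff_bijective.1 hsurj)
  refine ⟨e.symm, fun l n => ?_⟩
  rw [hs]
  exact if_congr ⟨fun h => e.eq_symm_apply.2 h.symm, fun h => (e.eq_symm_apply.1 h).symm⟩ rfl rfl

section Verlinde

variable {L : Type*} [Fintype L] [DecidableEq L] {S : Matrix L L ℂ}

theorem sum_mul_conj_eq_ite (hU : S * S.conjTranspose = 1) (hsymm : ∀ l m, S l m = S m l)
    (a b : L) : ∑ n, S n a * (starRingEnd ℂ) (S n b) = if a = b then 1 else 0 := by
  have h := congrFun (congrFun hU a) b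
  simp only [Matrix.mul_apply, Matrix.conjTranspose_apply, Matrix.one_apply] at h
  rw [← h]
  exact Finset.sum_congr rfl fun n _ => by rw [hsymm n a, hsymm n b]; rfl

/-- The columns of `S` are eigenvectors of the fusion matrices. -/
theorem sum_verlindeN_mul (hU : S * S.conjTranspose = 1) (hsymm : ∀ l m, S l m = S m l)
    (one k l m : L) :
    ∑ n, verlindeN S one k l n * S n m = S k m * S l m / S one m := by
  simp_rw [verlindeN, Finset.sum_mul]
  rw [Finset.sum_comm]
  calc ∑ d, ∑ n, S k d * S l d * (starRingEnd ℂ) (S n d) / S one d * S n m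
      = ∑ d, S k d * S l d / S one d * ∑ n, S n m * (starRingEnd ℂ) (S n d) := by
        refine Finset.sum_congr rfl fun d _ => ?_
        rw [Finset.mul_sum]
        exact Finset.sum_congr rfl fun n _ => by ring
    _ = S k m * S l m / S one m := by
        simp [sum_mul_conj_eq_ite hU hsymm]

/-- The conjugate columns of `S` are eigenvectors of the transposed fusion matrices. -/
theorem sum_verlindeN_mul_conj (hU : S * S.conjTranspose = 1) (hsymm : ∀ l m, S l m = S m l)
    (one k n m : L) :
    ∑ l, verlindeN S one k l n * (starRingEnd ℂ) (S l m) =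
      S k m * (starRingEnd ℂ) (S n m) / S one m := by
  simp_rw [verlindeN, Finset.sum_mul]
  rw [Finset.sum_comm]
  calc ∑ d, ∑ l, S k d * S l d * (starRingEnd ℂ) (S n d) / S one d * (starRingEnd ℂ) (S l m)
      = ∑ d, S k d * (starRingEnd ℂ) (S n d) / S one d *
          ∑ l, S l d * (starRingEnd ℂ) (S l m) := by
        refine Finset.sum_congr rfl fun d _ => ?_
        rw [Finset.mul_sum]
        exact Finset.sum_congr rfl fun n _ => by ring
    _ = S k m * (starRingEnd ℂ) (S n m) / S one m := by
        simp [sum_mul_conj_eq_ite hU hsymm]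

end Verlinde

/-- for a modular S-matrix, fusion with an automorphism `τ`
(`S 1 τ = S 1 1`) is a permutation `t` of the labels, and
`S (t λ) μ · S 1 μ = S τ μ · S λ μ` for all `λ, μ`. -/
theorem fusion_with_automorphism_is_permutation
    {L : Type*} [Fintype L] [DecidableEq L] (one : L) (S : Matrix L L ℂ)
    (hS : IsModularS one S) (τ : L) (hτ : S one τ = S one one) :
    ∃ t : L ≃ L,
      (∀ l n, verlindeN S one τ l n = if n = t l then 1 else 0) ∧
      (∀ l μ, S (t l) μ * S one μ = S τ μ * S l μ) := by
  obtain ⟨hU, hsymm, hpos, hN⟩ := hS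
  choose w hw hwS using hpos
  choose N hN using hN
  have hne : ∀ m, S one m ≠ 0 := fun m => by
    rw [hwS]
    exact_mod_cast (hw m).ne'
  have hS1 : ∀ l, S l one = w l := fun l => by rw [hsymm, hwS]
  have hτ1 : S τ one = S one one := by rw [hsymm, hτ]
  obtain ⟨t, ht⟩ := exists_equiv_of_nat_matrix_fixing_pos (N τ) w hw
    (fun l => by
      have h := sum_verlindeN_mul hU hsymm one τ l one
      rw [hτ1, mul_div_cancel_left₀ _ (hne one)] at h
      simp only [hN, hS1] at h
      exact_mod_cast h)
    (fun n => by
      have h := sum_verlindeN_mul_conj hU hsymm one τ n one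
      rw [hτ1, mul_div_cancel_left₀ _ (hne one)] at h
      simp only [hN, hS1, Complex.conj_ofReal] at h
      exact_mod_cast h)
  have hfusion : ∀ l n, verlindeN S one τ l n = if n = t l then 1 else 0 := fun l n => by
    rw [hN, ht]
    split_ifs <;> simp
  refine ⟨t, hfusion, fun l μ => ?_⟩
  have h := sum_verlindeN_mul hU hsymm one τ l μ
  simp only [hfusion, ite_mul, one_mul, zero_mul, Finset.sum_ite_eq',
    Finset.mem_univ, if_true] at h
  rw [h, div_mul_cancel₀ _ (hne μ)]
end

section
/- Let S be a modular S-matrix on a finite type L with distinguished element 1. Then S² is the permutation matrix of an involution λ ↦ λ̄ of L fixing 1: there exists an involutive bijection λ ↦ λ̄ of L with 1̄ = 1 such that (S·S) λ μ = 1 if μ = λ̄ and (S·S) λ μ = 0 otherwise; equivalently, N λ μ 1 = 1 if μ = λ̄ and N λ μ 1 = 0 otherwise. -/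
open scoped BigOperators

/-- The Verlinde numbers with vacuum output are the entries of `S²`. -/
theorem IsModularS.verlindeN_one {L : Type*} [Fintype L] [DecidableEq L] {one : L}
    {S : Matrix L L ℂ} (hS : IsModularS one S) (l m : L) :
    verlindeN S one l m one = (S * S) l m := by
  obtain ⟨-, hsymm, hpos, -⟩ := hS
  rw [verlindeN, Matrix.mul_apply]
  refine Finset.sum_congr rfl fun δ _ => ?_
  obtain ⟨r, hr, h⟩ := hpos δ
  have hr0 : (r : ℂ) ≠ 0 := by exact_mod_cast hr.ne'
  rw [h, Complex.conj_ofReal, mul_div_cancel_right₀ _ hr0, hsymm m δ]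

/-- A symmetric matrix of natural numbers whose rows have unit sum of squares is the permutation
matrix of an involution. -/
theorem exists_involutive_of_sum_sq_eq_one {L : Type*} [Fintype L] [DecidableEq L]
    (K : L → L → ℕ) (hsymm : ∀ l m, K l m = K m l) (hrow : ∀ l, ∑ m, K l m * K l m = 1) :
    ∃ f : L → L, Function.Involutive f ∧ ∀ l m, K l m = if m = f l then 1 else 0 := by
  have hex : ∀ l, ∃ m, K l m ≠ 0 := by
    intro l
    by_contra! h
    simpa [h] using hrow l
  choose f hf using hex
  have hK : ∀ l m, K l m = if m = f l then 1 else 0 := by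
    intro l m
    have hsum := hrow l
    rw [← Finset.add_sum_erase _ _ (Finset.mem_univ (f l))] at hsum
    have hpos : 0 < K l (f l) * K l (f l) := Nat.mul_pos (Nat.pos_of_ne_zero (hf l))
      (Nat.pos_of_ne_zero (hf l))
    split_ifs with h
    · subst h
      exact Nat.eq_one_of_mul_eq_one_left (by omega : K l (f l) * K l (f l) = 1)
    · have hzero : ∑ x ∈ Finset.univ.erase (f l), K l x * K l x = 0 := by omega
      have := Finset.sum_eq_zero_iff.mp hzero m (by simp [h])
      simpa using this
  refine ⟨f, fun l => ?_, hK⟩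
  by_contra h
  have h0 := hK (f l) l
  rw [if_neg (Ne.symm h)] at h0
  exact hf l (by rw [hsymm, h0])

/-- for a modular S-matrix, `S²` is the permutation matrix of an involution
`λ ↦ λ̄` fixing the vacuum; equivalently `N λ μ 1 = δ_{μ, λ̄}`. -/
theorem S_squared_is_charge_conjugation
    {L : Type*} [Fintype L] [DecidableEq L] (one : L) (S : Matrix L L ℂ)
    (hS : IsModularS one S) :
    ∃ bar : L ≃ L, (∀ l, bar (bar l) = l) ∧ bar one = one ∧
      (∀ l m, (S * S) l m = if m = bar l then 1 else 0) ∧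
      (∀ l m, verlindeN S one l m one = if m = bar l then 1 else 0) := by
  obtain ⟨hU, hsymm, hpos, hN⟩ := id hS
  have hV := hS.verlindeN_one
  choose K hK using fun l m => hN l m one
  have hC : ∀ l m, (S * S) l m = K l m := fun l m => by rw [← hV, hK]
  have hKsymm : ∀ l m, K l m = K m l := by
    intro l m
    have h : ((K l m : ℕ) : ℂ) = K m l := by
      rw [← hC, ← hC, Matrix.mul_apply, Matrix.mul_apply]
      refine Finset.sum_congr rfl fun δ _ => ?_
      rw [hsymm l δ, hsymm δ m, mul_comm]
    exact_mod_cast h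
  have hCU : (S * S) * (S * S).conjTranspose = 1 := by
    rw [Matrix.conjTranspose_mul, Matrix.mul_assoc, ← Matrix.mul_assoc S S.conjTranspose, hU,
      Matrix.one_mul, hU]
  have hrow : ∀ l, ∑ m, K l m * K l m = 1 := by
    intro l
    have h := congrFun (congrFun hCU l) l
    simp only [Matrix.mul_apply (M := S * S), Matrix.conjTranspose_apply, hC, Matrix.one_apply_eq,
      star_natCast] at h
    exact_mod_cast h
  obtain ⟨f, hf, hKf⟩ := exists_involutive_of_sum_sq_eq_one K hKsymm hrow
  have hSf : ∀ l m, (S * S) l m = if m = f l then 1 else 0 := by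
    intro l m
    rw [hC, hKf]
    split_ifs <;> simp
  have hone : (S * S) one one = 1 := by
    have h := congrFun (congrFun hU one) one
    rw [Matrix.one_apply_eq, Matrix.mul_apply] at h
    rw [← h, Matrix.mul_apply]
    refine Finset.sum_congr rfl fun δ _ => ?_
    obtain ⟨r, -, hr⟩ := hpos δ
    rw [Matrix.conjTranspose_apply, hsymm δ one, hr, Complex.star_def, Complex.conj_ofReal]
  refine ⟨hf.toPerm f, hf, ?_, hSf, fun l m => (hV l m).trans (hSf l m)⟩
  by_contra h
  have h0 := hSf one one
  rw [if_neg (show ¬one = f one from Ne.symm h), hone] at h0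
  exact one_ne_zero h0
end
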